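/- arXiv:1206.0511 — 3 statements merged into one kernel-verified Lean document; each statement's English description precedes it below -/
import Mathlib

section
/- Let S be a nonempty finite set of points in ℝ^N. Then there exists a simplicial complex K (a collection of finite affinely independent subsets of ℝ^N, closed under taking nonempty subsets, such that the convex hulls of any two faces intersect in the convex hull of their common vertices) whose underlying space (the union of the convex hulls of its faces) equals the convex hull of S, all of whose vertices belong to S, and moreover there is a point v ∈ S that belongs to every inclusion-maximal face of K. -/
namespace Geometry

open Finset

section LexPos

variable {E : Type*} [LinearOrder E]

/-- `u` is lexicographically positive on `S`: its first nonzero value on `S` is positive. -/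
def LexPos (S : Finset E) (u : E → ℝ) : Prop :=
  ∃ a ∈ S, (∀ b ∈ S, b < a → u b = 0) ∧ 0 < u a

theorem lexPos_or_lexPos_neg {S : Finset E} {u : E → ℝ} {x : E} (hx : x ∈ S) (hux : u x ≠ 0) :
    LexPos S u ∨ LexPos S (-u) := by
  have hne : {y ∈ S | u y ≠ 0}.Nonempty := ⟨x, by simp [hx, hux]⟩
  obtain ⟨haS, ha⟩ := mem_filter.1 (min'_mem _ hne)
  set a := min' _ hne
  have hzero : ∀ b ∈ S, b < a → u b = 0 := fun b hb hba => by
    by_contra h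
    exact hba.not_ge (min'_le _ b (by simp [hb, h]))
  rcases ha.lt_or_gt with h | h
  · exact .inr ⟨a, haS, by simpa using hzero, by simpa using h⟩
  · exact .inl ⟨a, haS, hzero, h⟩

theorem LexPos.smul {S : Finset E} {u : E → ℝ} (hu : LexPos S u) {ε : ℝ} (hε : 0 < ε) :
    LexPos S (ε • u) := by
  obtain ⟨a, ha, hzero, hpos⟩ := hu
  exact ⟨a, ha, fun b hb hba => by simp [hzero b hb hba], by simpa using mul_pos hε hpos⟩

theorem LexPos.congr {S : Finset E} {u v : E → ℝ} (hu : LexPos S u)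
    (h : ∀ x ∈ S, u x = v x) : LexPos S v := by
  obtain ⟨a, ha, hzero, hpos⟩ := hu
  exact ⟨a, ha, fun b hb hba => h b hb ▸ hzero b hb hba, h a ha ▸ hpos⟩

/-- A nonempty compact set of functions has an element that is lexicographically maximal
on a given finite set. -/
theorem exists_lexMax {C : Set (E → ℝ)} (hC : IsCompact C) (hne : C.Nonempty) (S : Finset E) :
    ∃ w ∈ C, ∀ w' ∈ C, ¬ LexPos S (w' - w) := by
  induction S using Finset.induction_on_max with
  | empty =>
    obtain ⟨w, hw⟩ := hne
    exact ⟨w, hw, fun w' _ ⟨a, ha, _⟩ => by simp at ha⟩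
  | insert a S hmax ih =>
    obtain ⟨w, hw, hwmax⟩ := ih
    have hclosed : IsClosed {w' : E → ℝ | ∀ b ∈ S, w' b = w b} := by
      simp only [Set.ofPred_forall]
      exact isClosed_biInter fun b _ => isClosed_eq (continuous_apply b) continuous_const
    obtain ⟨z, ⟨hzC, hzw⟩, hz⟩ := (hC.inter_right hclosed).exists_isMaxOn ⟨w, hw, fun _ _ => rfl⟩
      (continuous_apply a).continuousOn
    refine ⟨z, hzC, fun w' hw' ⟨c, hc, hzero, hpos⟩ => ?_⟩
    rcases mem_insert.1 hc with rfl | hcS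
    · have hw'w : ∀ b ∈ S, w' b = w b := fun b hb => by
        have := hzero b (mem_insert_of_mem hb) (hmax b hb)
        rw [← hzw b hb]
        simpa [sub_eq_zero] using this
      have : w' c ≤ z c := hz ⟨hw', hw'w⟩
      simp only [Pi.sub_apply] at hpos
      linarith
    · refine hwmax w' hw' ⟨c, hcS, fun b hb hbc => ?_, ?_⟩
      · simpa [hzw b hb] using hzero b (mem_insert_of_mem hb) hbc
      · simpa [hzw c hcS] using hpos

end LexPos

variable {E : Type*} [AddCommGroup E] [Module ℝ E]

/-- `w` is a system of convex weights on `S` with barycenter `x`. -/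
structure IsConvexWeight (S : Finset E) (w : E → ℝ) (x : E) : Prop where
  nonneg : ∀ y ∈ S, 0 ≤ w y
  sum_eq : ∑ y ∈ S, w y = 1
  sum_smul_eq : ∑ y ∈ S, w y • y = x

theorem mem_convexHull_iff_exists_isConvexWeight {S : Finset E} {x : E} :
    x ∈ convexHull ℝ (S : Set E) ↔ ∃ w, IsConvexWeight S w x := by
  rw [Finset.mem_convexHull']
  exact ⟨fun ⟨w, h₁, h₂, h₃⟩ => ⟨w, h₁, h₂, h₃⟩,
    fun ⟨w, hw⟩ => ⟨w, hw.nonneg, hw.sum_eq, hw.sum_smul_eq⟩⟩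

theorem IsConvexWeight.congr {S : Finset E} {w z : E → ℝ} {x : E} (hw : IsConvexWeight S w x)
    (h : ∀ y ∈ S, w y = z y) : IsConvexWeight S z x where
  nonneg y hy := h y hy ▸ hw.nonneg y hy
  sum_eq := by rw [← hw.sum_eq]; exact sum_congr rfl fun y hy => (h y hy).symm
  sum_smul_eq := by rw [← hw.sum_smul_eq]; exact sum_congr rfl fun y hy => by rw [h y hy]

theorem isConvexWeight_ite_iff [DecidableEq E] {S F : Finset E} (hF : F ⊆ S) {w : E → ℝ} {x : E} :
    IsConvexWeight S (fun y => if y ∈ F then w y else 0) x ↔ IsConvexWeight F w x := by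
  have h₁ : ∑ y ∈ S, (if y ∈ F then w y else 0) = ∑ y ∈ F, w y := by
    rw [sum_ite_mem, inter_eq_right.2 hF]
  have h₂ : ∑ y ∈ S, (if y ∈ F then w y else 0) • y = ∑ y ∈ F, w y • y := by
    simp only [ite_smul, zero_smul]
    rw [sum_ite_mem, inter_eq_right.2 hF]
  refine ⟨fun h => ⟨fun y hy => ?_, h₁ ▸ h.sum_eq, h₂ ▸ h.sum_smul_eq⟩,
    fun h => ⟨fun y _ => ?_, h₁.trans h.sum_eq, h₂.trans h.sum_smul_eq⟩⟩
  · simpa [hy] using h.nonneg y (hF hy)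
  · split_ifs with hy
    exacts [h.nonneg y hy, le_rfl]

/-- `u` is an affine relation between the points of `S`. -/
structure IsAffineRelation (S : Finset E) (u : E → ℝ) : Prop where
  sum_eq : ∑ y ∈ S, u y = 0
  sum_smul_eq : ∑ y ∈ S, u y • y = 0

theorem IsAffineRelation.neg {S : Finset E} {u : E → ℝ} (hu : IsAffineRelation S u) :
    IsAffineRelation S (-u) where
  sum_eq := by simp [hu.sum_eq]
  sum_smul_eq := by simp [hu.sum_smul_eq]

theorem IsConvexWeight.sub {S : Finset E} {w z : E → ℝ} {x : E} (hw : IsConvexWeight S w x)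
    (hz : IsConvexWeight S z x) : IsAffineRelation S (w - z) where
  sum_eq := by simp [hw.sum_eq, hz.sum_eq]
  sum_smul_eq := by simp [sub_smul, hw.sum_smul_eq, hz.sum_smul_eq]

theorem IsConvexWeight.exists_add_smul {S : Finset E} {w u : E → ℝ} {x : E}
    (hw : IsConvexWeight S w x) (hu : IsAffineRelation S u)
    (hnonneg : ∀ y ∈ S, w y = 0 → 0 ≤ u y) :
    ∃ ε : ℝ, 0 < ε ∧ IsConvexWeight S (w + ε • u) x := by
  have hev : ∀ᶠ ε : ℝ in nhdsWithin 0 (Set.Ioi 0), ∀ y ∈ S, 0 ≤ w y + ε * u y := by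
    rw [Filter.eventually_all_finset]
    intro y hy
    rcases (hw.nonneg y hy).eq_or_lt with h | h
    · filter_upwards [self_mem_nhdsWithin] with ε hε
      rw [← h, zero_add]
      exact mul_nonneg (le_of_lt hε) (hnonneg y hy h.symm)
    · have hcont : ContinuousAt (fun ε : ℝ => w y + ε * u y) 0 := by fun_prop
      exact ((hcont.eventually_const_lt (by simpa using h)).filter_mono nhdsWithin_le_nhds).mono
        fun _ => le_of_lt
  obtain ⟨ε, hε, hpos⟩ := (hev.and self_mem_nhdsWithin).exists
  refine ⟨ε, hpos, hε, ?_, ?_⟩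
  · simp [sum_add_distrib, ← mul_sum, hw.sum_eq, hu.sum_eq]
  · simp [add_smul, sum_add_distrib, mul_smul, ← smul_sum, hw.sum_smul_eq, hu.sum_smul_eq]

variable [LinearOrder E]

/-- `F` is a face of the pulling triangulation of `S`: no lexicographically positive affine
relation on `S` is nonnegative off `F`. Equivalently, convex weights supported on `F` are
lexicographically maximal among the convex weights on `S` with the same barycenter. -/
structure IsPullingFace (S F : Finset E) : Prop where
  subset : F ⊆ S
  not_lexPos : ∀ u, IsAffineRelation S u → (∀ y ∈ S, y ∉ F → 0 ≤ u y) → ¬ LexPos S u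

namespace IsPullingFace

variable {S F G : Finset E}

theorem mono (hF : IsPullingFace S F) (hGF : G ⊆ F) : IsPullingFace S G where
  subset := hGF.trans hF.subset
  not_lexPos u hu h := hF.not_lexPos u hu fun y hy hyF => h y hy fun hyG => hyF (hGF hyG)

/-- The first point of `S` can be added to every face. -/
theorem insert_of_forall_le (hF : IsPullingFace S F) {v : E} (hv : v ∈ S)
    (hmin : ∀ y ∈ S, v ≤ y) : IsPullingFace S (insert v F) where
  subset := insert_subset hv hF.subset
  not_lexPos u hu h hpos := by
    refine hF.not_lexPos u hu (fun y hy hyF => ?_) hpos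
    rcases eq_or_ne y v with rfl | hyv
    · obtain ⟨a, ha, hzero, hua⟩ := hpos
      rcases (hmin a ha).eq_or_lt with rfl | hlt
      exacts [hua.le, (hzero y hy hlt).ge]
    · exact h y hy (by simp [hyv, hyF])

theorem eq_zero_of_isAffineRelation (hF : IsPullingFace S F) {u : E → ℝ}
    (hu : IsAffineRelation S u) (h : ∀ y ∈ S, y ∉ F → u y = 0) : ∀ y ∈ S, u y = 0 := by
  intro y hy
  by_contra huy
  rcases lexPos_or_lexPos_neg hy huy with hpos | hpos
  · exact hF.not_lexPos u hu (fun y hy hyF => (h y hy hyF).ge) hpos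
  · exact hF.not_lexPos (-u) hu.neg (fun y hy hyF => by simp [h y hy hyF]) hpos

theorem affineIndependent (hF : IsPullingFace S F) :
    AffineIndependent ℝ ((↑) : F → E) := by
  rw [affineIndependent_iff_of_fintype]
  intro w hsum hsmul y
  rw [univ.weightedVSub_eq_linear_combination hsum] at hsmul
  set u : E → ℝ := fun y => if h : y ∈ F then w ⟨y, h⟩ else 0 with hu
  have hu_off : ∀ y ∈ S, y ∉ F → u y = 0 := fun y _ hy => by simp [hu, hy]
  have hu_coe : ∀ y : F, u y = w y := fun y => by simp [hu]
  have hrel : IsAffineRelation S u := by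
    constructor
    · rw [← sum_subset hF.subset hu_off, ← sum_coe_sort]
      simpa only [hu_coe] using hsum
    · rw [← sum_subset hF.subset fun y hy hyF => by rw [hu_off y hy hyF, zero_smul],
        ← sum_coe_sort]
      simpa only [hu_coe] using hsmul
  rw [← hu_coe]
  exact hF.eq_zero_of_isAffineRelation hrel hu_off y (hF.subset y.2)

theorem convexHull_inter_subset (hF : IsPullingFace S F) (hG : IsPullingFace S G) :
    convexHull ℝ (F : Set E) ∩ convexHull ℝ (G : Set E) ⊆ convexHull ℝ (F ∩ G : Set E) := by
  rintro x ⟨hxF, hxG⟩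
  obtain ⟨w, hw⟩ := mem_convexHull_iff_exists_isConvexWeight.1 hxF
  obtain ⟨z, hz⟩ := mem_convexHull_iff_exists_isConvexWeight.1 hxG
  rw [← isConvexWeight_ite_iff hF.subset] at hw
  rw [← isConvexWeight_ite_iff hG.subset] at hz
  set w' : E → ℝ := fun y => if y ∈ F then w y else 0 with hw'
  set z' : E → ℝ := fun y => if y ∈ G then z y else 0 with hz'
  have heq : ∀ y ∈ S, w' y = z' y := by
    intro y hy
    by_contra hne
    rcases lexPos_or_lexPos_neg (u := w' - z') hy (sub_ne_zero.2 hne) with hpos | hpos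
    · refine hG.not_lexPos _ (hw.sub hz) (fun y hy hyG => ?_) hpos
      simpa [hz', hyG] using hw.nonneg y hy
    · refine hF.not_lexPos _ (hw.sub hz).neg (fun y hy hyF => ?_) hpos
      simpa [hw', hyF] using hz.nonneg y hy
  rw [← coe_inter, mem_convexHull_iff_exists_isConvexWeight]
  refine ⟨w, (isConvexWeight_ite_iff (inter_subset_left.trans hF.subset)).1
    (hw.congr fun y hy => ?_)⟩
  by_cases hyG : y ∈ G
  · simp [hw', hyG]
  · have := heq y hy
    simpa [hw', hz', hyG] using this

end IsPullingFace

theorem exists_isConvexWeight_lexMax [TopologicalSpace E] [IsTopologicalAddGroup E]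
    [ContinuousSMul ℝ E] [T2Space E] {S : Finset E} {x : E}
    (hx : x ∈ convexHull ℝ (S : Set E)) :
    ∃ w, IsConvexWeight S w x ∧ ∀ z, IsConvexWeight S z x → ¬ LexPos S (z - w) := by
  set C : Set (E → ℝ) := Set.univ.pi (fun _ => Set.Icc 0 1) ∩ {w | IsConvexWeight S w x}
  have hclosed : IsClosed {w | IsConvexWeight S w x} := by
    have : {w | IsConvexWeight S w x} = (⋂ y ∈ S, {w | 0 ≤ w y}) ∩
        ({w | ∑ y ∈ S, w y = 1} ∩ {w | ∑ y ∈ S, w y • y = x}) := by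
      ext w
      simp only [Set.mem_ofPred_eq, Set.mem_inter_iff, Set.mem_iInter]
      exact ⟨fun h => ⟨h.1, h.2, h.3⟩, fun h => ⟨h.1, h.2.1, h.2.2⟩⟩
    rw [this]
    exact (isClosed_biInter fun y _ => isClosed_le continuous_const (continuous_apply y)).inter
      ((isClosed_eq (by fun_prop) continuous_const).inter
        (isClosed_eq (by fun_prop) continuous_const))
  have hcompact : IsCompact C := (isCompact_univ_pi fun _ => isCompact_Icc).inter_right hclosed
  have htrunc : ∀ z, IsConvexWeight S z x → (fun y => if y ∈ S then z y else 0) ∈ C := by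
    refine fun z hz => ⟨fun y _ => ?_, (isConvexWeight_ite_iff subset_rfl).2 hz⟩
    dsimp only
    split_ifs with hy
    · exact ⟨hz.nonneg y hy, hz.sum_eq ▸ single_le_sum hz.nonneg hy⟩
    · simp
  obtain ⟨w₀, hw₀⟩ := mem_convexHull_iff_exists_isConvexWeight.1 hx
  obtain ⟨w, hw, hmax⟩ := exists_lexMax hcompact ⟨_, htrunc w₀ hw₀⟩ S
  exact ⟨w, hw.2, fun z hz hpos => hmax _ (htrunc z hz) (hpos.congr fun y hy => by simp [hy])⟩

theorem exists_isPullingFace_mem_convexHull [TopologicalSpace E] [IsTopologicalAddGroup E]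
    [ContinuousSMul ℝ E] [T2Space E] {S : Finset E} {x : E}
    (hx : x ∈ convexHull ℝ (S : Set E)) :
    ∃ F, IsPullingFace S F ∧ x ∈ convexHull ℝ (F : Set E) := by
  obtain ⟨w, hw, hmax⟩ := exists_isConvexWeight_lexMax hx
  refine ⟨{y ∈ S | w y ≠ 0}, ⟨filter_subset _ _, fun u hu hnonneg hpos => ?_⟩, ?_⟩
  · obtain ⟨ε, hε, hwε⟩ := hw.exists_add_smul hu fun y hy hwy => hnonneg y hy (by simp [hwy])
    exact hmax _ hwε (by simpa using hpos.smul hε)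
  · refine mem_convexHull_iff_exists_isConvexWeight.2
      ⟨w, (isConvexWeight_ite_iff (filter_subset _ S)).1 (hw.congr fun y hy => ?_)⟩
    by_cases hwy : w y = 0 <;> simp [hy, hwy]

/-- The pulling triangulation of `S`. -/
def pullingTriangulation (S : Finset E) : SimplicialComplex ℝ E :=
  SimplicialComplex.ofErase {F | IsPullingFace S F} (fun _ hF => hF.affineIndependent)
    (fun _ _ hGF hF => hF.mono hGF) fun _ hF _ hG => hF.convexHull_inter_subset hG

theorem mem_faces_pullingTriangulation {S F : Finset E} :
    F ∈ (pullingTriangulation S).faces ↔ IsPullingFace S F ∧ F.Nonempty := by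
  rw [nonempty_iff_ne_empty]
  exact Iff.rfl

theorem space_pullingTriangulation [TopologicalSpace E] [IsTopologicalAddGroup E]
    [ContinuousSMul ℝ E] [T2Space E] (S : Finset E) :
    (pullingTriangulation S).space = convexHull ℝ (S : Set E) := by
  ext x
  simp only [SimplicialComplex.mem_space_iff, mem_faces_pullingTriangulation]
  refine ⟨fun ⟨F, hF, hx⟩ => convexHull_mono (coe_subset.2 hF.1.subset) hx, fun hx => ?_⟩
  obtain ⟨F, hF, hxF⟩ := exists_isPullingFace_mem_convexHull hx
  exact ⟨F, ⟨hF, coe_nonempty.1 (convexHull_nonempty_iff.1 ⟨x, hxF⟩)⟩, hxF⟩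

/-- The first point of `S` lies in every facet of the pulling triangulation. -/
theorem mem_of_mem_facets_pullingTriangulation {S F : Finset E} {v : E} (hv : v ∈ S)
    (hmin : ∀ y ∈ S, v ≤ y) (hF : F ∈ (pullingTriangulation S).facets) : v ∈ F := by
  have hins := (mem_faces_pullingTriangulation.1 hF.1).1.insert_of_forall_le hv hmin
  rw [hF.2 (mem_faces_pullingTriangulation.2 ⟨hins, insert_nonempty _ _⟩) (subset_insert _ _)]
  exact mem_insert_self _ _

end Geometry


/-- Every polytope (convex hull of a nonempty finite set `S` in `ℝ^N`) has a pointed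
triangulation: a simplicial complex with vertices in `S` whose underlying space is the
polytope, together with a point `v ∈ S` lying in every inclusion-maximal face. -/
theorem polytope_has_pointed_triangulation (N : ℕ) (S : Finset (Fin N → ℝ))
    (hS : S.Nonempty) :
    ∃ K : Geometry.SimplicialComplex ℝ (Fin N → ℝ),
      K.space = convexHull ℝ (S : Set (Fin N → ℝ)) ∧
      (∀ F ∈ K.faces, (F : Set (Fin N → ℝ)) ⊆ (S : Set (Fin N → ℝ))) ∧
      ∃ v ∈ S, ∀ F ∈ K.faces, (∀ G ∈ K.faces, F ⊆ G → F = G) → v ∈ F := by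
  obtain ⟨_, -⟩ := exists_wellFoundedLT (Fin N → ℝ)
  refine ⟨Geometry.pullingTriangulation S, Geometry.space_pullingTriangulation S,
    fun F hF => Finset.coe_subset.2 (Geometry.mem_faces_pullingTriangulation.1 hF).1.subset,
    S.min' hS, S.min'_mem hS, fun F hF hmax => ?_⟩
  exact Geometry.mem_of_mem_facets_pullingTriangulation (S.min'_mem hS) S.min'_le ⟨hF, hmax⟩
end

section
/- Let l ≥ 1 and d_1,…,d_l ≥ 1 be integers with d = d_1+⋯+d_l. For j = 1,…,l let e^j_0,…,e^j_{d_j} be the standard basis vectors of ℝ^{d_j+1} and let Δ^{d_j} = conv{e^j_0,…,e^j_{d_j}}. For each function w : {1,…,d} → {1,…,l} taking each value j exactly d_j times, and each 0 ≤ i ≤ d, let c_j(i) be the number of indices k ≤ i with w(k) = j, and let p_i = (e^1_{c_1(i)}, e^2_{c_2(i)}, …, e^l_{c_l(i)}) ∈ ℝ^{d_1+1} × ⋯ × ℝ^{d_l+1}. Then the product Δ^{d_1} × Δ^{d_2} × ⋯ × Δ^{d_l} equals the union over all such functions w of the convex hulls conv{p_0, p_1, …, p_d}. -/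
open Finset in
/-- The number of letters equal to `j` among the first `i` letters of the word `w`. -/
def prefixCount {α : Type*} [DecidableEq α] {n : ℕ} (w : Fin n → α) (i : ℕ) (j : α) : ℕ :=
  #{k : Fin n | (k : ℕ) < i ∧ w k = j}

section prefixCount

variable {α : Type*} [DecidableEq α] {n : ℕ}

theorem prefixCount_zero (w : Fin n → α) (j : α) : prefixCount w 0 j = 0 := by
  simp [prefixCount]

theorem prefixCount_cons_succ (a : α) (w : Fin n → α) (i : ℕ) (j : α) :
    prefixCount (Fin.cons a w : Fin (n + 1) → α) (i + 1) j =
      (if a = j then 1 else 0) + prefixCount w i j := by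
  simp only [prefixCount, Fin.card_filter_univ_succ, Fin.cons_zero,
    Fin.cons_succ, Fin.val_zero, Fin.val_succ, Nat.add_lt_add_iff_right, Nat.zero_lt_succ,
    true_and]
  split_ifs <;> omega

theorem ncard_prefix_eq_prefixCount (w : Fin n → α) (i : ℕ) (j : α) :
    Set.ncard {k : Fin n | (k : ℕ) < i ∧ w k = j} = prefixCount w i j := by
  rw [prefixCount, ← Set.ncard_coe_finset]
  simp

theorem ncard_fiber_eq_prefixCount (w : Fin n → α) (j : α) :
    Set.ncard {k : Fin n | w k = j} = prefixCount w n j := by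
  rw [← ncard_prefix_eq_prefixCount]
  simp

theorem prefixCount_le (w : Fin n → α) (i : ℕ) (j : α) :
    prefixCount w i j ≤ prefixCount w n j := by
  apply Finset.card_le_card
  intro k
  simp +contextual

end prefixCount

theorem eq_ite_of_sum_range_succ_eq {M : Type*} [AddCommMonoid M] {f : ℕ → M} {d : ℕ} {μ : M}
    (hf : ∀ t < d, f t = 0) (hsum : ∑ t ∈ Finset.range (d + 1), f t = μ) {t : ℕ} (ht : t ≤ d) :
    f t = if t = d then μ else 0 := by
  rw [Finset.sum_range_succ, Finset.sum_eq_zero fun s hs => hf s (Finset.mem_range.1 hs),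
    zero_add] at hsum
  split_ifs with h
  · rw [h, hsum]
  · exact hf t (by omega)

/-- A family of nonnegative functions `x j`, supported on `[a j, d j]` and with common total
mass `μ`, is carried by the points of some monotone lattice path from `a` to `d`. -/
theorem exists_monotone_path_weights {ι : Type*} [Fintype ι] [DecidableEq ι] (d : ι → ℕ) (n : ℕ)
    (a : ι → ℕ) (x : ι → ℕ → ℝ) (μ : ℝ) (had : ∀ j, a j ≤ d j)
    (hn : n + ∑ j, a j = ∑ j, d j) (hμ : 0 ≤ μ) (hx : ∀ j t, 0 ≤ x j t)
    (hxa : ∀ j t, t < a j → x j t = 0) (hsum : ∀ j, ∑ t ∈ Finset.range (d j + 1), x j t = μ) :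
    ∃ (w : Fin n → ι) (c : ℕ → ℝ), (∀ j, a j + prefixCount w n j = d j) ∧ (∀ i, 0 ≤ c i) ∧
      ∑ i ∈ Finset.range (n + 1), c i = μ ∧
      ∀ j, ∀ t ≤ d j, x j t =
        ∑ i ∈ Finset.range (n + 1), if t = a j + prefixCount w i j then c i else 0 := by
  induction n generalizing a x μ with
  | zero =>
    have heq : ∀ j, a j = d j := by
      have := (Finset.sum_eq_sum_iff_of_le (s := Finset.univ) (fun j _ => had j)).1 (by omega)
      exact fun j => this j (Finset.mem_univ j)
    refine ⟨Fin.elim0, fun _ => μ, fun j => ?_, fun _ => hμ, by simp, fun j t ht => ?_⟩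
    · simp [prefixCount_zero, heq]
    · rw [eq_ite_of_sum_range_succ_eq (fun s hs => hxa j s (heq j ▸ hs)) (hsum j) ht]
      simp [prefixCount_zero, heq]
  | succ n ih =>
    have hne : (Finset.univ.filter fun j => a j < d j).Nonempty := by
      by_contra h
      rw [Finset.not_nonempty_iff_eq_empty, Finset.filter_eq_empty_iff] at h
      have : ∑ j, d j ≤ ∑ j, a j :=
        Finset.sum_le_sum fun j _ => not_lt.1 (h (Finset.mem_univ j))
      omega
    obtain ⟨p, hp, hmin⟩ := Finset.exists_min_image _ (fun j => x j (a j)) hne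
    simp only [Finset.mem_filter, Finset.mem_univ, true_and] at hp hmin
    have hend : ∀ j, a j = d j → ∀ t ≤ d j, x j t = if t = d j then μ else 0 := fun j hj t ht =>
      eq_ite_of_sum_range_succ_eq (fun s hs => hxa j s (hj ▸ hs)) (hsum j) ht
    set m := x p (a p)
    have hmμ : m ≤ μ := by
      rw [← hsum p]
      exact Finset.single_le_sum (fun t _ => hx p t) (Finset.mem_range.2 (by omega))
    have hle : ∀ j, m ≤ x j (a j) := by
      intro j
      rcases (had j).lt_or_eq with h | h
      · exact hmin j h
      · rw [hend j h (a j) (had j), if_pos h]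
        exact hmμ
    set b : ι → ℕ := fun j => (if p = j then 1 else 0) + a j with hb
    set y : ι → ℕ → ℝ := fun j t => x j t - if t = a j then m else 0 with hy
    have hbd : ∀ j, b j ≤ d j := by
      intro j
      have := had j
      simp only [hb]
      split_ifs with h
      · subst h; omega
      · omega
    have hbn : n + ∑ j, b j = ∑ j, d j := by
      simp only [hb, Finset.sum_add_distrib, Finset.sum_ite_eq, Finset.mem_univ, if_true]
      omega
    have hy0 : ∀ j t, 0 ≤ y j t := by
      intro j t
      simp only [hy]
      split_ifs with h
      · rw [h]; linarith [hle j]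
      · simpa using hx j t
    have hyb : ∀ j t, t < b j → y j t = 0 := by
      intro j t ht
      simp only [hb] at ht
      simp only [hy]
      by_cases h : t = a j
      · have hpj : p = j := by
          by_contra hpj
          simp [hpj, h] at ht
        subst hpj
        rw [if_pos h, h, sub_self]
      · rw [if_neg h, sub_zero]
        exact hxa j t (by split_ifs at ht <;> omega)
    have hysum : ∀ j, ∑ t ∈ Finset.range (d j + 1), y j t = μ - m := by
      intro j
      have := had j
      simp only [hy, Finset.sum_sub_distrib, hsum j, Finset.sum_ite_eq', Finset.mem_range]
      rw [if_pos (by omega)]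
    obtain ⟨w, c, hw, hc, hcs, hyc⟩ :=
      ih b y (μ - m) hbd hbn (by linarith) hy0 hyb hysum
    refine ⟨Fin.cons p w, fun i => Nat.casesOn i m c, fun j => ?_, fun i => ?_, ?_,
      fun j t ht => ?_⟩
    · rw [prefixCount_cons_succ, ← hw j]
      simp only [hb]
      omega
    · cases i with
      | zero => exact hx p _
      | succ i => exact hc i
    · rw [Finset.sum_range_succ']
      exact (congrArg (· + m) hcs).trans (sub_add_cancel μ m)
    · rw [Finset.sum_range_succ']
      have hshift : ∀ i, a j + prefixCount (Fin.cons p w : Fin (n + 1) → ι) (i + 1) j =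
          b j + prefixCount w i j := by
        intro i
        rw [prefixCount_cons_succ]
        simp only [hb]
        omega
      simp only [hshift, prefixCount_zero, add_zero]
      rw [← hyc j t ht]
      simp [hy]

/-- The staircase triangulation of a product of standard simplexes
`Δ^{d_1} × ⋯ × Δ^{d_l}`: the product equals the union, over all words
`w : {0,…,d-1} → {1,…,l}` in which each letter `j` occurs exactly `d_j` times
(`d = d_1+⋯+d_l`), of the simplexes `conv{p_0,…,p_d}`, where
`p_i = (e^1_{c_1(i)},…,e^l_{c_l(i)})` and `c_j(i)` is the number of the first `i`
letters of `w` equal to `j`. -/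
theorem product_of_simplexes_eq_union_staircase (l : ℕ) (hl : 1 ≤ l)
    (dv : Fin l → ℕ) (hdv : ∀ j, 1 ≤ dv j) :
    {x : ∀ j : Fin l, Fin (dv j + 1) → ℝ |
        ∀ j, x j ∈ convexHull ℝ
          (Set.range fun m : Fin (dv j + 1) => (Pi.single m (1 : ℝ) : Fin (dv j + 1) → ℝ))} =
      ⋃ w ∈ {w : Fin (∑ j, dv j) → Fin l | ∀ j, Set.ncard {k | w k = j} = dv j},
        convexHull ℝ
          ((fun i : ℕ => fun j : Fin l => fun t : Fin (dv j + 1) =>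
              if (t : ℕ) = Set.ncard {k : Fin (∑ j', dv j') | (k : ℕ) < i ∧ w k = j}
              then (1 : ℝ) else 0) '' {i : ℕ | i ≤ ∑ j, dv j}) := by
  simp only [ncard_prefix_eq_prefixCount, ncard_fiber_eq_prefixCount]
  ext x
  simp only [convexHull_rangle_single_eq_stdSimplex, Set.mem_ofPred_eq, Set.mem_iUnion,
    exists_prop]
  constructor
  · intro hx
    set X : Fin l → ℕ → ℝ := fun j t => if h : t < dv j + 1 then x j ⟨t, h⟩ else 0 with hX
    have hXval : ∀ j (t : Fin (dv j + 1)), X j t = x j t := fun j t => dif_pos t.2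
    obtain ⟨w, c, hw, hc, hcs, hxc⟩ := exists_monotone_path_weights dv (∑ j, dv j) 0 X 1
      (fun _ => Nat.zero_le _) (by simp) zero_le_one
      (fun j t => by
        simp only [hX]
        split_ifs
        exacts [(hx j).1 _, le_rfl])
      (fun j t h => by simp at h)
      (fun j => by
        rw [Finset.sum_range, ← (hx j).2]
        exact Finset.sum_congr rfl fun t _ => hXval j t)
    refine ⟨w, fun j => by simpa using hw j, ?_⟩
    have hmem := (convex_convexHull ℝ
      ((fun i : ℕ => fun j : Fin l => fun t : Fin (dv j + 1) =>
        if (t : ℕ) = prefixCount w i j then (1 : ℝ) else 0) '' {i : ℕ | i ≤ ∑ j, dv j})).sum_mem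
      (fun i _ => hc i) hcs
      (fun i hi => subset_convexHull ℝ _
        (Set.mem_image_of_mem _ (Nat.lt_succ_iff.1 (Finset.mem_range.1 hi))))
    convert hmem using 1
    ext j t
    rw [← hXval, hxc j t (Nat.lt_succ_iff.1 t.2)]
    simp [Finset.sum_apply]
  · rintro ⟨w, hw, hx⟩ j
    have hconv : Convex ℝ {y : ∀ j : Fin l, Fin (dv j + 1) → ℝ |
        ∀ j, y j ∈ stdSimplex ℝ (Fin (dv j + 1))} := by
      intro y hy z hz r s hr hs hrs j
      exact convex_stdSimplex ℝ _ (hy j) (hz j) hr hs hrs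
    refine convexHull_min ?_ hconv hx j
    rintro _ ⟨i, -, rfl⟩ j
    have hlt : prefixCount w i j < dv j + 1 :=
      Nat.lt_succ_iff.2 ((prefixCount_le w i j).trans_eq (hw j))
    convert single_mem_stdSimplex ℝ (⟨prefixCount w i j, hlt⟩ : Fin (dv j + 1)) using 1
    ext t
    simp [Pi.single_apply, Fin.ext_iff]
end

section
/- Let m ≥ 1. For every 0 ≤ i ≤ m-1, let N_i be the number of functions w : {1,…,2m} → {1,2} such that w takes each value exactly m times, every prefix contains at least as many 1's as 2's, and w has exactly i descents (indices p with w(p)=2 and w(p+1)=1). Then m · N_i = C(m, i+1) · C(m, i). -/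
/-- The number of descents of a word `w` indexed by `{0,…,D-1}`:
indices `p` with `p+1 ≤ D-1` and `w p > w (p+1)`. -/
noncomputable def descCount {D : ℕ} {α : Type*} [LT α] (w : Fin D → α) : ℕ :=
  Set.ncard {p : Fin D | ∃ q : Fin D, (q : ℕ) = (p : ℕ) + 1 ∧ w q < w p}

theorem fin_two_eq_zero_or_one (x : Fin 2) : x = 0 ∨ x = 1 := by
  revert x
  decide

theorem ncard_setOf_fin_succ {n : ℕ} (P : Fin (n + 1) → Prop) [Decidable (P (Fin.last n))] :
    Set.ncard {k | P k} =
      Set.ncard {k : Fin n | P k.castSucc} + if P (Fin.last n) then 1 else 0 := by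
  classical
  simp only [Set.ncard_eq_toFinset_card', Set.toFinset_ofPred, Finset.card_filter,
    Fin.sum_univ_castSucc]
  congr!

theorem descCount_succ {n : ℕ} (w : Fin (n + 1) → Fin 2) :
    descCount w = Set.ncard {p : Fin n | w p.succ < w p.castSucc} := by
  classical
  unfold descCount
  rw [ncard_setOf_fin_succ, if_neg, add_zero]
  · congr 1
    ext p
    constructor
    · rintro ⟨q, hq, h⟩
      obtain rfl : q = p.succ := Fin.ext (by simpa using hq)
      exact h
    · exact fun h => ⟨p.succ, by simp, h⟩
  · rintro ⟨q, hq, -⟩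
    have := q.isLt
    simp at hq
    omega

theorem descCount_snoc {n : ℕ} (w : Fin (n + 1) → Fin 2) (x : Fin 2) :
    descCount (Fin.snoc w x : Fin (n + 2) → Fin 2) =
      descCount w + if x < w (Fin.last n) then 1 else 0 := by
  rw [descCount_succ, descCount_succ, ncard_setOf_fin_succ]
  simp only [Fin.succ_castSucc, Fin.succ_last, Fin.snoc_castSucc, Fin.snoc_last]

theorem ncard_snoc_eq {n : ℕ} (w : Fin n → Fin 2) (x j : Fin 2) :
    Set.ncard {k | (Fin.snoc w x : Fin (n + 1) → Fin 2) k = j} =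
      Set.ncard {k | w k = j} + if x = j then 1 else 0 := by
  rw [ncard_setOf_fin_succ]
  simp only [Fin.snoc_castSucc, Fin.snoc_last]

/-- Every prefix of `w` contains at least as many `0`s as `1`s. -/
def IsBallot {n : ℕ} (w : Fin n → Fin 2) : Prop :=
  ∀ p : ℕ, Set.ncard {k : Fin n | (k : ℕ) < p ∧ w k = 1} ≤
    Set.ncard {k : Fin n | (k : ℕ) < p ∧ w k = 0}

theorem setOf_lt_and_eq_of_le {n p : ℕ} (h : n ≤ p) (w : Fin n → Fin 2) (j : Fin 2) :
    {k : Fin n | (k : ℕ) < p ∧ w k = j} = {k | w k = j} := by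
  ext k
  have := k.isLt
  simp only [Set.mem_ofPred_eq, and_iff_right_iff_imp]
  omega

theorem ncard_snoc_lt_and_eq {n p : ℕ} (h : p ≤ n) (w : Fin n → Fin 2) (x j : Fin 2) :
    Set.ncard {k : Fin (n + 1) | (k : ℕ) < p ∧ (Fin.snoc w x : Fin (n + 1) → Fin 2) k = j} =
      Set.ncard {k : Fin n | (k : ℕ) < p ∧ w k = j} := by
  rw [ncard_setOf_fin_succ]
  simp [Nat.not_lt.mpr h]

theorem IsBallot.ncard_le {n : ℕ} {w : Fin n → Fin 2} (h : IsBallot w) :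
    Set.ncard {k | w k = 1} ≤ Set.ncard {k | w k = 0} := by
  simpa only [setOf_lt_and_eq_of_le le_rfl] using h n

theorem isBallot_snoc {n : ℕ} (w : Fin n → Fin 2) (x : Fin 2) :
    IsBallot (Fin.snoc w x : Fin (n + 1) → Fin 2) ↔
      IsBallot w ∧ Set.ncard {k | w k = 1} + (if x = 1 then 1 else 0) ≤
        Set.ncard {k | w k = 0} + (if x = 0 then 1 else 0) := by
  constructor
  · intro h
    refine ⟨fun p => ?_, ?_⟩
    · rcases le_total p n with hp | hp
      · simpa only [ncard_snoc_lt_and_eq hp] using h p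
      · simpa only [setOf_lt_and_eq_of_le hp, setOf_lt_and_eq_of_le le_rfl,
          ncard_snoc_lt_and_eq le_rfl] using h n
    · simpa only [ncard_snoc_eq] using h.ncard_le
  · rintro ⟨h, h'⟩ p
    rcases le_or_gt p n with hp | hp
    · simpa only [ncard_snoc_lt_and_eq hp] using h p
    · simpa only [setOf_lt_and_eq_of_le (Nat.succ_le_of_lt hp), ncard_snoc_eq] using h'

/-- Ballot words of length `n + 1` with `a` letters `0`, `b` letters `1`, `i` descents and
last letter `x`. -/
def ballotWords (n a b i : ℕ) (x : Fin 2) : Set (Fin (n + 1) → Fin 2) :=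
  {w | Set.ncard {k | w k = 0} = a ∧ Set.ncard {k | w k = 1} = b ∧ IsBallot w ∧
    descCount w = i ∧ w (Fin.last n) = x}

theorem snoc_mem_ballotWords {n a b i : ℕ} {x y : Fin 2} {w : Fin (n + 1) → Fin 2} :
    (Fin.snoc w y : Fin (n + 2) → Fin 2) ∈ ballotWords (n + 1) a b i x ↔
      (Set.ncard {k | w k = 0} + (if y = 0 then 1 else 0) = a ∧
        Set.ncard {k | w k = 1} + (if y = 1 then 1 else 0) = b ∧ IsBallot w ∧ b ≤ a ∧
        descCount w + (if y < w (Fin.last n) then 1 else 0) = i ∧ y = x) := by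
  simp only [ballotWords, Set.mem_ofPred_eq, ncard_snoc_eq, isBallot_snoc, descCount_snoc,
    Fin.snoc_last]
  constructor
  · rintro ⟨rfl, rfl, ⟨h, h'⟩, h₂, h₃⟩
    exact ⟨rfl, rfl, h, h', h₂, h₃⟩
  · rintro ⟨rfl, rfl, h, h', h₂, h₃⟩
    exact ⟨rfl, rfl, ⟨h, h'⟩, h₂, h₃⟩

theorem ncard_ballotWords_union (n a b i : ℕ) (j : ℕ) :
    (ballotWords n a b i 0 ∪ ballotWords n a b j 1).ncard =
      (ballotWords n a b i 0).ncard + (ballotWords n a b j 1).ncard := by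
  refine Set.ncard_union_eq (Set.disjoint_left.mpr ?_)
  rintro w ⟨-, -, -, -, h⟩ ⟨-, -, -, -, h'⟩
  exact absurd (h.symm.trans h') (by decide)

theorem ncard_eq_of_forall_snoc {n : ℕ} {S : Set (Fin (n + 1) → Fin 2)}
    {T : Set (Fin n → Fin 2)} (x : Fin 2) (hlast : ∀ w ∈ S, w (Fin.last n) = x)
    (h : ∀ w, (Fin.snoc w x : Fin (n + 1) → Fin 2) ∈ S ↔ w ∈ T) : S.ncard = T.ncard := by
  rw [← Set.ncard_image_of_injective T
    (f := fun w => (Fin.snoc w x : Fin (n + 1) → Fin 2))]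
  · congr 1
    ext w
    constructor
    · intro hw
      have e : (Fin.snoc (Fin.init w) x : Fin (n + 1) → Fin 2) = w := by
        rw [← hlast w hw, Fin.snoc_init_self]
      exact ⟨Fin.init w, (h _).mp (e.symm ▸ hw), e⟩
    · rintro ⟨v, hv, rfl⟩
      exact (h v).mpr hv
  · intro v w hvw
    simpa using congrArg (Fin.init (α := fun _ => Fin 2)) hvw

theorem ballotWords_last {n a b i : ℕ} {x : Fin 2} :
    ∀ w ∈ ballotWords n a b i x, w (Fin.last n) = x :=
  fun _ hw => hw.2.2.2.2

theorem ballotWords_one_zero (n a i : ℕ) : ballotWords n a 0 i 1 = ∅ := by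
  refine Set.eq_empty_of_forall_notMem ?_
  rintro w ⟨-, h, -, -, h'⟩
  rw [Set.ncard_eq_zero] at h
  exact (h ▸ h' : Fin.last n ∈ (∅ : Set (Fin (n + 1))))

theorem ncard_ballotWords_one (n i : ℕ) {a b : ℕ} (h : b + 1 ≤ a) :
    (ballotWords (n + 1) a (b + 1) i 1).ncard =
      (ballotWords n a b i 0).ncard + (ballotWords n a b i 1).ncard := by
  rw [← ncard_ballotWords_union]
  refine ncard_eq_of_forall_snoc 1 ballotWords_last fun w => ?_
  rw [snoc_mem_ballotWords]
  have := fin_two_eq_zero_or_one (w (Fin.last n))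
  simp only [ballotWords, Set.mem_union, Set.mem_ofPred_eq]
  rcases this with e | e <;> simp [e, h]

theorem ncard_ballotWords_zero_zero (n : ℕ) {a b : ℕ} (h : b ≤ a) :
    (ballotWords (n + 1) (a + 1) b 0 0).ncard = (ballotWords n a b 0 0).ncard := by
  refine ncard_eq_of_forall_snoc 0 ballotWords_last fun w => ?_
  rw [snoc_mem_ballotWords]
  have := fin_two_eq_zero_or_one (w (Fin.last n))
  simp only [ballotWords, Set.mem_ofPred_eq]
  rcases this with e | e <;> simp [e, h.trans (Nat.le_succ a)]

theorem ncard_ballotWords_zero_succ (n i : ℕ) {a b : ℕ} (h : b ≤ a) :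
    (ballotWords (n + 1) (a + 1) b (i + 1) 0).ncard =
      (ballotWords n a b (i + 1) 0).ncard + (ballotWords n a b i 1).ncard := by
  rw [← ncard_ballotWords_union]
  refine ncard_eq_of_forall_snoc 0 ballotWords_last fun w => ?_
  rw [snoc_mem_ballotWords]
  have := fin_two_eq_zero_or_one (w (Fin.last n))
  simp only [ballotWords, Set.mem_union, Set.mem_ofPred_eq]
  rcases this with e | e <;> simp [e, h.trans (Nat.le_succ a)]

theorem ballotWords_zero_diagonal (n a i : ℕ) : ballotWords (n + 1) a a i 0 = ∅ := by
  refine Set.eq_empty_of_forall_notMem fun w hw => ?_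
  have e : (Fin.snoc (Fin.init w) 0 : Fin (n + 2) → Fin 2) = w := by
    rw [← ballotWords_last w hw, Fin.snoc_init_self]
  rw [← e, snoc_mem_ballotWords] at hw
  obtain ⟨h₀, h₁, h, -⟩ := hw
  have := h.ncard_le
  simp at h₀ h₁
  omega

/-- The number of lattice paths with `a` east steps and `b ≤ a` north steps that stay weakly
below the diagonal and have `i` north-east turns. -/
def turnCount (a b : ℕ) : ℕ → ℤ
  | 0 => 1
  | i + 1 => a.choose (i + 1) * b.choose (i + 1) - (a - 1).choose i * (b + 1).choose (i + 2)

/-- The number of those paths counted by `turnCount` whose last step is north. -/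
def turnCountNorth (a : ℕ) : ℕ → ℕ → ℤ
  | 0, _ => 0
  | b + 1, i => turnCount a b i

theorem turnCount_diagonal (a i : ℕ) :
    turnCount (a + 1) (a + 1) i = turnCount (a + 1) a i := by
  cases i with
  | zero => rfl
  | succ i =>
    simp only [turnCount, Nat.add_sub_cancel, Nat.choose_succ_succ, Nat.succ_eq_add_one]
    push_cast
    ring

theorem turnCount_succ_left_zero (a b : ℕ) :
    turnCount (a + 1) b 0 - turnCountNorth (a + 1) b 0 =
      turnCount a b 0 - turnCountNorth a b 0 := by
  cases b <;> rfl

theorem turnCount_succ_left_succ (a b i : ℕ) :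
    turnCount (a + 2) b (i + 1) - turnCountNorth (a + 2) b (i + 1) =
      turnCount (a + 1) b (i + 1) - turnCountNorth (a + 1) b (i + 1) +
        turnCountNorth (a + 1) b i := by
  cases b with
  | zero => simp [turnCount, turnCountNorth, Nat.choose_eq_zero_of_lt]
  | succ b =>
    cases i with
    | zero =>
      simp [turnCount, turnCountNorth, Nat.choose_succ_succ]
      ring
    | succ i =>
      simp only [turnCount, turnCountNorth, Nat.add_sub_cancel, Nat.choose_succ_succ,
        Nat.succ_eq_add_one, show a + 2 - 1 = a + 1 from rfl]
      push_cast
      ring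

theorem ncard_ballotWords_length_one (i : ℕ) :
    (ballotWords 0 1 0 i 0).ncard = if i = 0 then 1 else 0 := by
  have hd (w : Fin (0 + 1) → Fin 2) : descCount w = 0 := by
    rw [descCount_succ, Set.ncard_eq_zero]
    exact Set.eq_empty_of_isEmpty _
  split_ifs with hi
  · rw [Set.ncard_eq_one]
    refine ⟨fun _ => 0, Set.eq_singleton_iff_unique_mem.mpr ⟨?_, fun w hw => ?_⟩⟩
    · exact ⟨by simp, by simp, fun p => by simp, (hd _).trans hi.symm, rfl⟩
    · funext k
      rw [← ballotWords_last w hw, show k = Fin.last 0 from Fin.ext (by simp)]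
  · rw [Set.ncard_eq_zero]
    refine Set.eq_empty_of_forall_notMem ?_
    rintro w ⟨-, -, -, h, -⟩
    exact hi (h.symm.trans (hd w))

theorem ncard_ballotWords (n : ℕ) : ∀ a b i : ℕ, a + b = n + 1 → b ≤ a →
    ((ballotWords n a b i 1).ncard : ℤ) = turnCountNorth a b i ∧
      ((ballotWords n a b i 0).ncard : ℤ) = turnCount a b i - turnCountNorth a b i := by
  induction n with
  | zero =>
    intro a b i h hba
    obtain rfl : b = 0 := by omega
    obtain rfl : a = 1 := by omega
    refine ⟨by simp [ballotWords_one_zero, turnCountNorth], ?_⟩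
    rw [ncard_ballotWords_length_one]
    cases i <;> simp [turnCount, turnCountNorth, Nat.choose_eq_zero_of_lt]
  | succ n ih =>
    intro a b i h hba
    constructor
    · cases b with
      | zero => simp [ballotWords_one_zero, turnCountNorth]
      | succ b =>
        obtain ⟨h₁, h₀⟩ := ih a b i (by omega) (by omega)
        rw [ncard_ballotWords_one n i hba, Nat.cast_add, h₁, h₀, turnCountNorth]
        ring
    · rcases hba.eq_or_lt with rfl | hlt
      · obtain ⟨c, rfl⟩ : ∃ c, b = c + 1 := ⟨b - 1, by omega⟩
        simp [ballotWords_zero_diagonal, turnCountNorth, turnCount_diagonal]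
      · obtain ⟨c, rfl⟩ : ∃ c, a = c + 2 := ⟨a - 2, by omega⟩
        cases i with
        | zero =>
          rw [ncard_ballotWords_zero_zero n (by omega),
            (ih (c + 1) b 0 (by omega) (by omega)).2, turnCount_succ_left_zero (c + 1) b]
        | succ i =>
          rw [ncard_ballotWords_zero_succ n i (by omega), Nat.cast_add,
            (ih (c + 1) b (i + 1) (by omega) (by omega)).2,
            (ih (c + 1) b i (by omega) (by omega)).1, turnCount_succ_left_succ]

theorem succ_mul_turnCount_diagonal (n i : ℕ) :
    ((n + 1 : ℕ) : ℤ) * turnCount (n + 1) (n + 1) i =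
      (n + 1).choose (i + 1) * (n + 1).choose i := by
  cases i with
  | zero => simp [turnCount]
  | succ i =>
    rw [turnCount_diagonal]
    simp only [turnCount, Nat.add_sub_cancel]
    have h₁ := Nat.add_one_mul_choose_eq n i
    have h₂ := Nat.add_one_mul_choose_eq n (i + 1)
    zify at h₁ h₂
    push_cast
    linear_combination ((n + 1).choose (i + 1) : ℤ) * h₂ - ((n + 1).choose (i + 2) : ℤ) * h₁

/-- Narayana numbers count ballot sequences by descents: if `N_i` is the number of
words `w : {0,…,2m-1} → {1,2}` (encoded as `Fin 2`, with `0` standing for the letter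
`1` and `1` for the letter `2`) taking each value exactly `m` times, in which every
prefix contains at least as many `1`s as `2`s, and with exactly `i` descents, then
`m · N_i = C(m, i+1) · C(m, i)`. -/
theorem ballot_sequences_descents_narayana (m : ℕ) (hm : 1 ≤ m) (i : ℕ)
    (hi : i ≤ m - 1) :
    m * Set.ncard {w : Fin (2 * m) → Fin 2 |
        (∀ j, Set.ncard {k | w k = j} = m) ∧
        (∀ p : ℕ, Set.ncard {k : Fin (2 * m) | (k : ℕ) < p ∧ w k = 1} ≤
            Set.ncard {k : Fin (2 * m) | (k : ℕ) < p ∧ w k = 0}) ∧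
        descCount w = i} =
      Nat.choose m (i + 1) * Nat.choose m i := by
  obtain ⟨n, rfl⟩ : ∃ n, m = n + 1 := ⟨m - 1, by omega⟩
  obtain ⟨h₁, h₀⟩ := ncard_ballotWords (2 * n + 1) (n + 1) (n + 1) i (by omega) le_rfl
  have key : Set.ncard {w : Fin (2 * (n + 1)) → Fin 2 |
        (∀ j, Set.ncard {k | w k = j} = n + 1) ∧
        (∀ p : ℕ, Set.ncard {k : Fin (2 * (n + 1)) | (k : ℕ) < p ∧ w k = 1} ≤
            Set.ncard {k : Fin (2 * (n + 1)) | (k : ℕ) < p ∧ w k = 0}) ∧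
        descCount w = i} =
      (ballotWords (2 * n + 1) (n + 1) (n + 1) i 0 ∪
        ballotWords (2 * n + 1) (n + 1) (n + 1) i 1).ncard := by
    congr 1
    ext w
    have e := fin_two_eq_zero_or_one (w (Fin.last (2 * n + 1)))
    simp only [Fin.forall_fin_two, ballotWords, IsBallot, Set.mem_union, Set.mem_ofPred_eq]
    constructor
    · rintro ⟨⟨h0, h1⟩, hb, hd⟩
      exact e.imp (fun e => ⟨h0, h1, hb, hd, e⟩) fun e => ⟨h0, h1, hb, hd, e⟩
    · rintro (⟨h0, h1, hb, hd, -⟩ | ⟨h0, h1, hb, hd, -⟩) <;> exact ⟨⟨h0, h1⟩, hb, hd⟩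
  rw [key, ncard_ballotWords_union]
  have := succ_mul_turnCount_diagonal n i
  zify
  rw [h₀, h₁, sub_add_cancel]
  exact_mod_cast this
end
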